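/- Let d ≥ 1, s ∈ (0,1) and c_s := 2 sin(πs)/π. Let F, G : ℝ^d → ℂ be measurable functions such that ∫_{ℝ^d} |ζ|^{2s} |F(ζ)| |G(ζ)| dζ < ∞. Then (i) the double integral converges absolutely: ∫₀^∞ t^{1-2s} ∫_{ℝ^d} (|ζ|²/(1+t²|ζ|²)) |F(ζ)| |G(ζ)| dζ dt = (1/c_s) ∫_{ℝ^d} |ζ|^{2s} |F(ζ)| |G(ζ)| dζ < ∞; and (ii) c_s ∫₀^∞ t^{1-2s} ∫_{ℝ^d} (|ζ|²/(1+t²|ζ|²)) F(ζ) \overline{G(ζ)} dζ dt = ∫_{ℝ^d} |ζ|^{2s} F(ζ) \overline{G(ζ)} dζ. -/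

import Mathlib

open MeasureTheory Real Complex

lemma lintegral_exp_neg_mul_Ioi {a : ℝ} (ha : 0 < a) :
    ∫⁻ x in Set.Ioi (0 : ℝ), ENNReal.ofReal (Real.exp (-a * x)) = ENNReal.ofReal a⁻¹ := by
  rw [← ofReal_integral_eq_lintegral_ofReal (exp_neg_integrableOn_Ioi 0 ha)
    (Filter.Eventually.of_forall fun x => (Real.exp_pos _).le),
    integral_exp_mul_Ioi (neg_lt_zero.2 ha) 0]
  simp

lemma lintegral_rpow_mul_exp_neg_mul_rpow {p q b : ℝ} (hp : 1 ≤ p) (hq : -1 < q) (hb : 0 < b) :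
    ∫⁻ x in Set.Ioi (0 : ℝ), ENNReal.ofReal (x ^ q * Real.exp (-b * x ^ p)) =
      ENNReal.ofReal (b ^ (-(q + 1) / p) * (1 / p) * Real.Gamma ((q + 1) / p)) := by
  rw [← integral_rpow_mul_exp_neg_mul_rpow (by linarith) hq hb,
    ofReal_integral_eq_lintegral_ofReal (integrableOn_rpow_mul_exp_neg_mul_rpow hq (by linarith) hb)]
  filter_upwards [ae_restrict_mem measurableSet_Ioi] with x hx
  exact mul_nonneg (rpow_nonneg (le_of_lt hx) _) (Real.exp_pos _).le

/-- The spectral kernel `t ^ (1 - 2s) r² / (1 + t² r²)` integrates over `t > 0` to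
`r ^ (2s) π / (2 sin (π s))`. -/
lemma lintegral_rpow_mul_sq_div_one_add_sq {s : ℝ} (hs : s ∈ Set.Ioo (0 : ℝ) 1) {r : ℝ}
    (hr : 0 ≤ r) :
    ∫⁻ t in Set.Ioi (0 : ℝ), ENNReal.ofReal (t ^ (1 - 2 * s) * (r ^ 2 / (1 + t ^ 2 * r ^ 2))) =
      ENNReal.ofReal ((2 * Real.sin (π * s) / π)⁻¹ * r ^ (2 * s)) := by
  obtain ⟨hs0, hs1⟩ := hs
  rcases hr.eq_or_lt with rfl | hr
  · simp [zero_rpow (by linarith : 2 * s ≠ 0)]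
  have hexp : ∀ t ∈ Set.Ioi (0 : ℝ),
      ENNReal.ofReal (t ^ (1 - 2 * s) * (r ^ 2 / (1 + t ^ 2 * r ^ 2))) =
        ∫⁻ x in Set.Ioi (0 : ℝ), ENNReal.ofReal (r ^ 2 * Real.exp (-x)) *
          ENNReal.ofReal (t ^ (1 - 2 * s) * Real.exp (-(x * r ^ 2) * t ^ (2 : ℝ))) := by
    intro t ht
    have ht' : 0 ≤ t ^ (1 - 2 * s) := rpow_nonneg (le_of_lt ht) _
    have ha : 0 < 1 + t ^ 2 * r ^ 2 := by positivity
    rw [div_eq_mul_inv, ← mul_assoc, ENNReal.ofReal_mul (by positivity),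
      ← lintegral_exp_neg_mul_Ioi ha, ← lintegral_const_mul _ (by fun_prop)]
    refine lintegral_congr fun x => ?_
    rw [← ENNReal.ofReal_mul (by positivity), ← ENNReal.ofReal_mul (by positivity)]
    congr 1
    have : Real.exp (-(1 + t ^ 2 * r ^ 2) * x) =
        Real.exp (-x) * Real.exp (-(x * r ^ 2) * t ^ (2 : ℝ)) := by
      rw [← Real.exp_add, Real.rpow_two]
      ring_nf
    rw [this]
    ring
  have hgauss : ∀ x ∈ Set.Ioi (0 : ℝ),
      (∫⁻ t in Set.Ioi (0 : ℝ), ENNReal.ofReal (r ^ 2 * Real.exp (-x)) *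
        ENNReal.ofReal (t ^ (1 - 2 * s) * Real.exp (-(x * r ^ 2) * t ^ (2 : ℝ)))) =
      ENNReal.ofReal (r ^ (2 * s) * (1 / 2) * Real.Gamma (1 - s)) *
        ENNReal.ofReal (x ^ (s - 1) * Real.exp (-1 * x ^ (1 : ℝ))) := by
    intro x hx
    have hx : 0 < x := hx
    have hΓ : 0 < Real.Gamma (1 - s) := Real.Gamma_pos_of_pos (by linarith)
    rw [lintegral_const_mul _ (by fun_prop),
      lintegral_rpow_mul_exp_neg_mul_rpow one_le_two (by linarith) (by positivity),
      ← ENNReal.ofReal_mul (by positivity), ← ENNReal.ofReal_mul (by positivity),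
      show (1 - 2 * s + 1) / 2 = 1 - s by ring, show -(1 - 2 * s + 1) / 2 = s - 1 by ring,
      mul_rpow hx.le (by positivity), ← Real.rpow_natCast r 2, ← Real.rpow_mul hr.le,
      Real.rpow_one, neg_one_mul]
    congr 1
    have : r ^ (2 * s) = r ^ ((2 : ℕ) : ℝ) * r ^ (((2 : ℕ) : ℝ) * (s - 1)) := by
      rw [← Real.rpow_add hr]
      congr 1
      push_cast
      ring
    rw [this]
    ring
  rw [setLIntegral_congr_fun measurableSet_Ioi hexp, lintegral_lintegral_swap (by fun_prop),
    setLIntegral_congr_fun measurableSet_Ioi hgauss, lintegral_const_mul _ (by fun_prop),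
    lintegral_rpow_mul_exp_neg_mul_rpow le_rfl (by linarith) one_pos,
    ← ENNReal.ofReal_mul
      (by have := Real.Gamma_pos_of_pos (by linarith : 0 < 1 - s); positivity)]
  congr 1
  have hΓ := Real.Gamma_mul_Gamma_one_sub s
  rw [Real.one_rpow, show (s - 1 + 1) / 1 = s by ring]
  calc r ^ (2 * s) * (1 / 2) * Real.Gamma (1 - s) * (1 * (1 / 1) * Real.Gamma s)
      = r ^ (2 * s) * (1 / 2) * (Real.Gamma s * Real.Gamma (1 - s)) := by ring
    _ = _ := by rw [hΓ, inv_div, ← div_div]; ring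

lemma integral_rpow_mul_sq_div_one_add_sq {s : ℝ} (hs : s ∈ Set.Ioo (0 : ℝ) 1) {r : ℝ}
    (hr : 0 ≤ r) :
    ∫ t in Set.Ioi (0 : ℝ), t ^ (1 - 2 * s) * (r ^ 2 / (1 + t ^ 2 * r ^ 2)) =
      (2 * Real.sin (π * s) / π)⁻¹ * r ^ (2 * s) := by
  have hsin : 0 < Real.sin (π * s) :=
    Real.sin_pos_of_pos_of_lt_pi (mul_pos pi_pos hs.1) (by nlinarith [pi_pos, hs.2])
  rw [integral_eq_lintegral_of_nonneg_ae, lintegral_rpow_mul_sq_div_one_add_sq hs hr,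
    ENNReal.toReal_ofReal (by positivity)]
  · filter_upwards [ae_restrict_mem measurableSet_Ioi] with t ht
    have := rpow_nonneg (le_of_lt ht) (1 - 2 * s)
    simp only [Pi.zero_apply]
    positivity
  · exact Measurable.aestronglyMeasurable (by fun_prop)

/-- Let `d ≥ 1`, `s ∈ (0,1)` and `c_s := 2 sin(π s)/π`.  Let `F, G : ℝ^d → ℂ` be measurable
with `∫ |ζ|^(2s) |F(ζ)| |G(ζ)| dζ < ∞`.  Then (i) the double integral converges absolutely:
`∫₀^∞ t^(1-2s) ∫ (|ζ|²/(1+t²|ζ|²)) |F| |G| dζ dt = (1/c_s) ∫ |ζ|^(2s) |F| |G| dζ < ∞`,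
and (ii) `c_s ∫₀^∞ t^(1-2s) ∫ (|ζ|²/(1+t²|ζ|²)) F(ζ) conj (G ζ) dζ dt
  = ∫ |ζ|^(2s) F(ζ) conj (G ζ) dζ`. -/
theorem stmt_2 (d : ℕ) (hd : 1 ≤ d) (s : ℝ) (hs : s ∈ Set.Ioo (0 : ℝ) 1)
    (F G : EuclideanSpace ℝ (Fin d) → ℂ) (hF : Measurable F) (hG : Measurable G)
    (hFG : Integrable (fun ζ => ‖ζ‖ ^ (2 * s) * (‖F ζ‖ * ‖G ζ‖)) volume) :
    (∫⁻ t in Set.Ioi (0 : ℝ),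
        ENNReal.ofReal (t ^ (1 - 2 * s)) *
          ∫⁻ ζ : EuclideanSpace ℝ (Fin d),
            ENNReal.ofReal (‖ζ‖ ^ 2 / (1 + t ^ 2 * ‖ζ‖ ^ 2) * (‖F ζ‖ * ‖G ζ‖)))
      = ENNReal.ofReal
          ((2 * Real.sin (π * s) / π)⁻¹ * ∫ ζ, ‖ζ‖ ^ (2 * s) * (‖F ζ‖ * ‖G ζ‖)) ∧
    (((2 * Real.sin (π * s) / π : ℝ) : ℂ) *
        ∫ t in Set.Ioi (0 : ℝ), ((t ^ (1 - 2 * s) : ℝ) : ℂ) *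
          ∫ ζ : EuclideanSpace ℝ (Fin d),
            ((‖ζ‖ ^ 2 / (1 + t ^ 2 * ‖ζ‖ ^ 2) : ℝ) : ℂ) * (F ζ * starRingEnd ℂ (G ζ)))
      = ∫ ζ : EuclideanSpace ℝ (Fin d),
          ((‖ζ‖ ^ (2 * s) : ℝ) : ℂ) * (F ζ * starRingEnd ℂ (G ζ)) := by
  have hsin : 0 < Real.sin (π * s) :=
    Real.sin_pos_of_pos_of_lt_pi (mul_pos pi_pos hs.1) (by nlinarith [pi_pos, hs.2])
  have hc : 0 < 2 * Real.sin (π * s) / π := by positivity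
  have habs : (∫⁻ t in Set.Ioi (0 : ℝ), ∫⁻ ζ : EuclideanSpace ℝ (Fin d),
        ENNReal.ofReal (t ^ (1 - 2 * s) * (‖ζ‖ ^ 2 / (1 + t ^ 2 * ‖ζ‖ ^ 2))) *
          ENNReal.ofReal (‖F ζ‖ * ‖G ζ‖)) =
      ENNReal.ofReal
        ((2 * Real.sin (π * s) / π)⁻¹ * ∫ ζ, ‖ζ‖ ^ (2 * s) * (‖F ζ‖ * ‖G ζ‖)) := by
    rw [lintegral_lintegral_swap (by fun_prop), ← integral_const_mul,
      ofReal_integral_eq_lintegral_ofReal (hFG.const_mul _)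
        (Filter.Eventually.of_forall fun ζ => by positivity)]
    refine lintegral_congr fun ζ => ?_
    rw [lintegral_mul_const _ (by fun_prop),
      lintegral_rpow_mul_sq_div_one_add_sq hs (norm_nonneg ζ),
      ← ENNReal.ofReal_mul (by positivity), mul_assoc]
  constructor
  · rw [← habs]
    refine setLIntegral_congr_fun measurableSet_Ioi fun t ht => ?_
    have ht' : 0 ≤ t ^ (1 - 2 * s) := rpow_nonneg (le_of_lt ht) _
    rw [← lintegral_const_mul _ (by fun_prop)]
    refine lintegral_congr fun ζ => ?_
    rw [← ENNReal.ofReal_mul ht', ← ENNReal.ofReal_mul (by positivity), mul_assoc]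
  · have hint : Integrable (Function.uncurry fun (t : ℝ) (ζ : EuclideanSpace ℝ (Fin d)) =>
        ((t ^ (1 - 2 * s) * (‖ζ‖ ^ 2 / (1 + t ^ 2 * ‖ζ‖ ^ 2)) : ℝ) : ℂ) *
          (F ζ * starRingEnd ℂ (G ζ))) ((volume.restrict (Set.Ioi (0 : ℝ))).prod volume) := by
      have hmeas : Measurable (Function.uncurry fun (t : ℝ) (ζ : EuclideanSpace ℝ (Fin d)) =>
          ((t ^ (1 - 2 * s) * (‖ζ‖ ^ 2 / (1 + t ^ 2 * ‖ζ‖ ^ 2)) : ℝ) : ℂ) *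
            (F ζ * starRingEnd ℂ (G ζ))) := by
        have hconj : Measurable (starRingEnd ℂ) := Complex.continuous_conj.measurable
        unfold Function.uncurry
        fun_prop
      refine ⟨hmeas.aestronglyMeasurable, ?_⟩
      rw [hasFiniteIntegral_iff_enorm, lintegral_prod _ hmeas.enorm.aemeasurable]
      refine lt_of_eq_of_lt (Eq.trans ?_ habs) ENNReal.ofReal_lt_top
      refine setLIntegral_congr_fun measurableSet_Ioi fun t ht => lintegral_congr fun ζ => ?_
      have ht' : 0 ≤ t ^ (1 - 2 * s) := rpow_nonneg (le_of_lt ht) _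
      have hk : 0 ≤ t ^ (1 - 2 * s) * (‖ζ‖ ^ 2 / (1 + t ^ 2 * ‖ζ‖ ^ 2)) := by positivity
      rw [← ENNReal.ofReal_mul hk, ← ofReal_norm, Function.uncurry_apply_pair, norm_mul,
        norm_mul, Complex.norm_real, Real.norm_of_nonneg hk, RCLike.norm_conj]
    have hswap := integral_integral_swap hint
    have hinner : ∀ t : ℝ, ((t ^ (1 - 2 * s) : ℝ) : ℂ) *
          ∫ ζ : EuclideanSpace ℝ (Fin d),
            ((‖ζ‖ ^ 2 / (1 + t ^ 2 * ‖ζ‖ ^ 2) : ℝ) : ℂ) * (F ζ * starRingEnd ℂ (G ζ)) =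
        ∫ ζ : EuclideanSpace ℝ (Fin d),
          ((t ^ (1 - 2 * s) * (‖ζ‖ ^ 2 / (1 + t ^ 2 * ‖ζ‖ ^ 2)) : ℝ) : ℂ) *
            (F ζ * starRingEnd ℂ (G ζ)) := by
      intro t
      rw [← integral_const_mul]
      simp only [Complex.ofReal_mul, mul_assoc]
    simp only [hinner]
    rw [hswap, ← integral_const_mul]
    congr 1
    funext ζ
    rw [integral_mul_const, integral_complex_ofReal,
      integral_rpow_mul_sq_div_one_add_sq hs (norm_nonneg ζ), ← mul_assoc, ← Complex.ofReal_mul,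
      mul_inv_cancel_left₀ hc.ne']
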